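/- arXiv:1809.01719 — 3 statements merged into one kernel-verified Lean document; each statement's English description precedes it below -/
import Mathlib

section
/- Let g(y) = 𝔞·y on ℕ with 𝔞 > 0, let 0 < p ≤ 1, let θ = σ be any real number (so Z(θ) = exp(e^θ/𝔞) < ∞ and μ^θ is a Poisson distribution), and let μ̂ = μ^θ. Then the single-shock measure ν_j satisfies the random walking shock property with rates P = p·𝔞 and Q = (1−p)·𝔞, i.e. for every bounded cylinder function φ, ∫Lφ dν_j = p𝔞·(∫φ dν_{j+1} − ∫φ dν_j) + (1−p)𝔞·(∫φ dν_{j−1} − ∫φ dν_j). -/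
open MeasureTheory Real

noncomputable def gfact (g : ℕ → ℝ) (z : ℕ) : ℝ := ∏ y ∈ Finset.Icc 1 z, g y

noncomputable def ZN (g : ℕ → ℝ) (θ : ℝ) : ℝ := ∑' z : ℕ, exp (θ * z) / gfact g z

noncomputable def muN (g : ℕ → ℝ) (θ : ℝ) (z : ℕ) : ℝ := exp (θ * z) / (gfact g z * ZN g θ)

abbrev ConfN : Type := ℤ → ℕ

/-- The configuration with one particle moved from site `i` to site `j`. -/
def moveN (η : ConfN) (i j : ℤ) : ConfN :=
  fun k => if k = i then η k - 1 else if k = j then η k + 1 else η k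

/-- The coupled zero range generator with right-jump probability `p` and rate function `g`,
acting on functions of the coupled pair of configurations. -/
noncomputable def LN (p : ℝ) (g : ℕ → ℝ) (φ : ConfN × ConfN → ℝ) (x : ConfN × ConfN) : ℝ :=
  ∑' i : ℤ,
    (p * g (x.1 i) * (φ (moveN x.1 i (i + 1), moveN x.2 i (i + 1)) - φ x)
      + p * (g (x.2 i) - g (x.1 i)) * (φ (x.1, moveN x.2 i (i + 1)) - φ x)
      + (1 - p) * g (x.1 i) * (φ (moveN x.1 i (i - 1), moveN x.2 i (i - 1)) - φ x)
      + (1 - p) * (g (x.2 i) - g (x.1 i)) * (φ (x.1, moveN x.2 i (i - 1)) - φ x))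

/-- A bounded cylinder function: bounded and depending on finitely many coordinates. -/
def IsBddCylinder (φ : ConfN × ConfN → ℝ) : Prop :=
  (∃ s : Finset ℤ, ∀ x y : ConfN × ConfN,
      (∀ i ∈ s, x.1 i = y.1 i ∧ x.2 i = y.2 i) → φ x = φ y)
    ∧ ∃ C : ℝ, ∀ x, |φ x| ≤ C

/-- The discrete measure on ℕ × ℕ with mass function `f`. -/
noncomputable def siteMeasure (f : ℕ × ℕ → ℝ) : Measure (ℕ × ℕ) :=
  Measure.count.withDensity fun yz => ENNReal.ofReal (f yz)

/-- `ν` is the product measure on `(ℕ × ℕ)^ℤ` with the given site marginals: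
every cylinder event has product probability. -/
def IsProductMeasure (fac : ℤ → Measure (ℕ × ℕ)) (ν : Measure (ConfN × ConfN)) : Prop :=
  ∀ (s : Finset ℤ) (B : ℤ → Set (ℕ × ℕ)),
    ν {x : ConfN × ConfN | ∀ i ∈ s, (x.1 i, x.2 i) ∈ B i} = ∏ i ∈ s, fac i (B i)

/-- The site marginals of the single-shock measure `ν_j`: the image of `μ^θ` under
`y ↦ (y,y)` for `i < j`, the image of `μ̂` under `y ↦ (y,y+1)` at `i = j`, and the image of
`μ^σ` under `y ↦ (y,y)` for `i > j`. -/
noncomputable def shockFactor (g : ℕ → ℝ) (θ σ : ℝ) (μhat : ℕ → ℝ) (j i : ℤ) :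
    Measure (ℕ × ℕ) :=
  if i < j then siteMeasure fun yz => if yz.2 = yz.1 then muN g θ yz.1 else 0
  else if i = j then siteMeasure fun yz => if yz.2 = yz.1 + 1 then μhat yz.1 else 0
  else siteMeasure fun yz => if yz.2 = yz.1 then muN g σ yz.1 else 0

open ProbabilityTheory in
/-- One-site Mecke formula. -/
lemma poisson_mecke (r : NNReal) (f : ℕ → ENNReal) :
    ∫⁻ n, (n : ENNReal) * f n ∂(poissonMeasure r) = r * ∫⁻ n, f (n + 1) ∂(poissonMeasure r) := by
  rw [lintegral_countable', lintegral_countable', tsum_eq_zero_add' ENNReal.summable]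
  simp only [Nat.cast_zero, zero_mul, zero_add]
  rw [← ENNReal.tsum_mul_left]
  refine tsum_congr fun n => ?_
  rw [poissonMeasure_singleton, poissonMeasure_singleton]
  have h : ((n + 1 : ℕ) : ENNReal) * ENNReal.ofReal (exp (-r) * r ^ (n + 1) / ((n + 1).factorial : ℝ))
      = r * ENNReal.ofReal (exp (-r) * r ^ n / (n.factorial : ℝ)) := by
    rw [← ENNReal.ofReal_natCast, ← ENNReal.ofReal_coe_nnreal,
      ← ENNReal.ofReal_mul (by positivity), ← ENNReal.ofReal_mul (by positivity)]
    congr 1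
    rw [Nat.factorial_succ]
    push_cast
    field_simp
    ring
  calc _ = (((n + 1 : ℕ) : ENNReal) *
        ENNReal.ofReal (exp (-r) * r ^ (n + 1) / ((n + 1).factorial : ℝ))) * f (n + 1) := by ring
    _ = _ := by rw [h]; ring

/-- Add a particle at `i`. -/
def addD (η : ConfN) (i : ℤ) : ConfN := Function.update η i (η i + 1)

lemma addD_apply (η : ConfN) (i k : ℤ) : addD η i k = if k = i then η k + 1 else η k := by
  unfold addD
  by_cases h : k = i
  · subst h; simp
  · simp [h]

lemma addD_comm (η : ConfN) (i k : ℤ) : addD (addD η i) k = addD (addD η k) i := by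
  ext l
  simp only [addD_apply]
  split_ifs <;> rfl

lemma moveN_addD (η : ConfN) (i k : ℤ) (h : k ≠ i) : moveN (addD η i) i k = addD η k := by
  ext l
  simp only [addD_apply, moveN]
  by_cases h1 : l = i
  · subst h1; simp [h.symm]
  · simp [h1]

lemma measurable_addD (i : ℤ) : Measurable fun η : ConfN => addD η i := by
  refine measurable_pi_lambda _ fun k => ?_
  simp only [addD_apply]
  split_ifs <;> fun_prop

lemma measurable_moveN (i k : ℤ) : Measurable fun η : ConfN => moveN η i k := by
  refine measurable_pi_lambda _ fun l => ?_
  simp only [moveN]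
  split_ifs
  · exact (measurable_of_countable (fun n : ℕ => n - 1)).comp (measurable_pi_apply l)
  · fun_prop
  · fun_prop

/-- The product Poisson measure. -/
noncomputable def poisPi (r : NNReal) : Measure ConfN :=
  Measure.infinitePi fun _ : ℤ => ProbabilityTheory.poissonMeasure r

instance (r : NNReal) : IsProbabilityMeasure (poisPi r) := by
  unfold poisPi; infer_instance

lemma measurable_upd (i : ℤ) :
    Measurable fun q : ℕ × ConfN => (Function.update q.2 i q.1 : ConfN) := by
  refine measurable_pi_lambda _ fun k => ?_
  by_cases h : k = i
  · subst h; simpa using measurable_fst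
  · simp only [Function.update_of_ne h]; fun_prop

lemma poisPi_split (r : NNReal) (i : ℤ) :
    ((ProbabilityTheory.poissonMeasure r).prod (poisPi r)).map
      (fun q : ℕ × ConfN => (Function.update q.2 i q.1 : ConfN)) = poisPi r := by
  refine Measure.eq_infinitePi _ fun s t ht => ?_
  rw [Measure.map_apply (measurable_upd i)
    (MeasurableSet.pi s.countable_toSet fun k _ => ht k)]
  have : (fun q : ℕ × ConfN => (Function.update q.2 i q.1 : ConfN)) ⁻¹' (Set.pi s t)
      = (if i ∈ s then t i else Set.univ) ×ˢ (Set.pi (s.erase i : Finset ℤ) t) := by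
    ext ⟨n, η⟩
    simp only [Set.mem_preimage, Set.mem_pi, Set.mem_prod, Finset.mem_coe, Finset.mem_erase]
    constructor
    · intro h
      refine ⟨?_, fun k hk => by simpa [hk.1] using h k hk.2⟩
      split_ifs with hi
      · simpa using h i hi
      · trivial
    · rintro ⟨h1, h2⟩ k hk
      by_cases hki : k = i
      · subst hki; simpa [hk] using h1
      · simpa [hki] using h2 k ⟨hki, hk⟩
  rw [this, Measure.prod_prod, poisPi, Measure.infinitePi_pi _ (fun k _ => ht k)]
  split_ifs with hi
  · rw [Finset.mul_prod_erase s (fun k => ProbabilityTheory.poissonMeasure r (t k)) hi]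
  · rw [Finset.erase_eq_of_notMem hi]; simp

lemma mecke (r : NNReal) (i : ℤ) :
    (poisPi r).withDensity (fun η => ((η i : NNReal) : ENNReal))
      = (r : ENNReal) • (poisPi r).map (fun η => addD η i) := by
  have key : ∀ F : ConfN → ENNReal, Measurable F →
      ∫⁻ η, ((η i : NNReal) : ENNReal) * F η ∂(poisPi r) = r * ∫⁻ η, F (addD η i) ∂(poisPi r) := by
    intro F hF
    have e1 : Measurable fun η : ConfN => ((η i : NNReal) : ENNReal) * F η := by
      refine Measurable.mul ?_ hF
      exact (measurable_of_countable (fun n : ℕ => ((n : NNReal) : ENNReal))).comp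
        (measurable_pi_apply i)
    have e2 : Measurable fun η : ConfN => F (addD η i) := hF.comp (measurable_addD i)
    conv_lhs => rw [← poisPi_split r i]
    conv_rhs => rw [← poisPi_split r i]
    rw [lintegral_map e1 (measurable_upd i), lintegral_map e2 (measurable_upd i),
      lintegral_prod_symm (fun q : ℕ × ConfN => ((Function.update q.2 i q.1 i : NNReal) : ENNReal)
        * F (Function.update q.2 i q.1)) (e1.comp (measurable_upd i)).aemeasurable,
      lintegral_prod_symm (fun q : ℕ × ConfN => F (addD (Function.update q.2 i q.1) i))
        (e2.comp (measurable_upd i)).aemeasurable,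
      ← lintegral_const_mul]
    · refine lintegral_congr fun η => ?_
      have := poisson_mecke r (fun n => F (Function.update η i n))
      simpa [addD] using this
    · exact (e2.comp (measurable_upd i)).lintegral_prod_left'
  ext A hA
  rw [withDensity_apply _ hA, Measure.smul_apply, Measure.map_apply (measurable_addD i) hA,
    ← lintegral_indicator hA]
  have := key (A.indicator 1) (measurable_one.indicator hA)
  have h2 : ∀ η : ConfN, A.indicator (1 : ConfN → ENNReal) (addD η i)
      = ((fun η => addD η i) ⁻¹' A).indicator 1 η := fun η => rfl
  simp only [h2] at this
  rw [lintegral_indicator_one (measurable_addD i hA)] at this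
  rw [smul_eq_mul, ← this]
  refine lintegral_congr fun η => ?_
  by_cases h : η ∈ A <;> simp [h]

lemma mecke_integrable (r : NNReal) (i : ℤ) (F : ConfN → ℝ) (hF : Measurable F) (C : ℝ)
    (hC : ∀ η, |F η| ≤ C) : Integrable (fun η => (η i : ℝ) * F η) (poisPi r) := by
  have hm : Measurable fun η : ConfN => (η i : NNReal) :=
    (measurable_of_countable (fun n : ℕ => (n : NNReal))).comp (measurable_pi_apply i)
  have h := (integrable_withDensity_iff_integrable_smul (μ := poisPi r) hm (g := F)).1 (by
    rw [mecke]
    refine Integrable.smul_measure ?_ (by simp)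
    have : IsProbabilityMeasure ((poisPi r).map fun η => addD η i) :=
      Measure.isProbabilityMeasure_map (measurable_addD i).aemeasurable
    exact Integrable.of_bound hF.aestronglyMeasurable C (.of_forall hC))
  simpa [NNReal.smul_def] using h

lemma mecke_integral (r : NNReal) (i : ℤ) (F : ConfN → ℝ) (hF : Measurable F) :
    ∫ η, (η i : ℝ) * F η ∂(poisPi r) = r * ∫ η, F (addD η i) ∂(poisPi r) := by
  have hm : Measurable fun η : ConfN => (η i : NNReal) :=
    (measurable_of_countable (fun n : ℕ => (n : NNReal))).comp (measurable_pi_apply i)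
  have h := integral_withDensity_eq_integral_smul (μ := poisPi r) hm F
  rw [mecke, integral_smul_measure,
    integral_map (measurable_addD i).aemeasurable hF.aestronglyMeasurable] at h
  simpa [NNReal.smul_def] using h.symm

lemma muN_eq (𝔞 θ : ℝ) (h𝔞 : 0 < 𝔞) (g : ℕ → ℝ) (hg : ∀ y : ℕ, g y = 𝔞 * y) (z : ℕ) :
    muN g θ z = exp (-(exp θ / 𝔞)) * (exp θ / 𝔞) ^ z / (z.factorial : ℝ) := by
  have hf : ∀ n, gfact g n = 𝔞 ^ n * (n.factorial : ℝ) := by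
    intro n
    induction n with
    | zero => simp [gfact]
    | succ n ih =>
      have : gfact g (n + 1) = gfact g n * g (n + 1) := by
        unfold gfact; rw [Finset.prod_Icc_succ_top (by omega)]
      rw [this, ih, hg, Nat.factorial_succ]; push_cast; ring
  have hterm : ∀ n : ℕ, exp (θ * n) / gfact g n = (exp θ / 𝔞) ^ n / (n.factorial : ℝ) := by
    intro n
    rw [hf, mul_comm θ, exp_nat_mul, div_pow, div_div]
  have hZ : ZN g θ = exp (exp θ / 𝔞) := by
    unfold ZN
    simp only [hterm]
    rw [(NormedSpace.expSeries_div_hasSum_exp (exp θ / 𝔞)).tsum_eq, ← exp_eq_exp_ℝ]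
  unfold muN
  rw [← div_div, hterm, hZ, exp_neg]
  ring

lemma site_eq (r : NNReal) (f : ℕ → ℝ)
    (hf : ∀ z, f z = exp (-r) * (r : ℝ) ^ z / (z.factorial : ℝ)) (d : ℕ) :
    siteMeasure (fun yz => if yz.2 = yz.1 + d then f yz.1 else 0)
      = (ProbabilityTheory.poissonMeasure r).map (fun y => (y, y + d)) := by
  refine Measure.ext_of_singleton fun ⟨a, b⟩ => ?_
  rw [siteMeasure, withDensity_apply _ (measurableSet_singleton _), lintegral_singleton,
    Measure.map_apply (by fun_prop) (measurableSet_singleton _)]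
  simp only [Measure.count_singleton, mul_one]
  split_ifs with h
  · have : (fun y : ℕ => (y, y + d)) ⁻¹' {(a, b)} = {a} := by
      ext y; simp only [Set.mem_preimage, Set.mem_singleton_iff, Prod.mk.injEq]; omega
    rw [this, ProbabilityTheory.poissonMeasure_singleton, hf]
  · have : (fun y : ℕ => (y, y + d)) ⁻¹' {(a, b)} = ∅ := by
      ext y
      simp only [Set.mem_preimage, Set.mem_singleton_iff, Prod.mk.injEq, Set.mem_empty_iff_false,
        iff_false]
      omega
    simp [this]

lemma nu_eq (𝔞 θ : ℝ) (h𝔞 : 0 < 𝔞) (g : ℕ → ℝ) (hg : ∀ y : ℕ, g y = 𝔞 * y) (r : NNReal)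
    (hr : (r : ℝ) = exp θ / 𝔞) (j : ℤ) (ν : Measure (ConfN × ConfN))
    (hν : IsProductMeasure (shockFactor g θ θ (muN g θ) j) ν) :
    ν = (poisPi r).map (fun η => (η, addD η j)) := by
  have hf : ∀ z, muN g θ z = exp (-r) * (r : ℝ) ^ z / (z.factorial : ℝ) := by
    intro z; rw [muN_eq 𝔞 θ h𝔞 g hg, hr]
  have hfac : ∀ i, shockFactor g θ θ (muN g θ) j i = (ProbabilityTheory.poissonMeasure r).map
      (fun y => (y, y + if i = j then 1 else 0)) := by
    intro i
    unfold shockFactor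
    have h0 := site_eq r _ hf 0
    have h1 := site_eq r _ hf 1
    simp only [add_zero] at h0
    rcases lt_trichotomy i j with h | h | h
    · rw [if_pos h, h0]; simp [h.ne]
    · subst h; rw [if_neg (lt_irrefl _), if_pos rfl, h1]; simp
    · rw [if_neg (not_lt.2 h.le), if_neg h.ne', h0]; simp [h.ne']
  have hpm : Measurable fun η : ConfN => (η, addD η j) :=
    measurable_id.prodMk (measurable_addD j)
  let e : (ℤ → ℕ × ℕ) ≃ᵐ ConfN × ConfN := MeasurableEquiv.arrowProdEquivProdArrow ℕ ℕ ℤ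
  have h1 : ν.map e.symm = Measure.infinitePi fun i => (ProbabilityTheory.poissonMeasure r).map
      (fun y => (y, y + if i = j then 1 else 0)) := by
    have (i : ℤ) : IsProbabilityMeasure ((ProbabilityTheory.poissonMeasure r).map
      (fun y => (y, y + if i = j then 1 else 0))) :=
      Measure.isProbabilityMeasure_map (by fun_prop)
    refine Measure.eq_infinitePi _ fun s t ht => ?_
    rw [e.symm.map_apply]
    have := hν s t
    simp only [hfac] at this
    rw [← this]
    rfl
  rw [← Measure.infinitePi_map_pi _ (fun i => by fun_prop)] at h1
  have h2 : ν = (ν.map e.symm).map e := by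
    rw [Measure.map_map e.measurable e.symm.measurable]; simp
  rw [h2, h1, Measure.map_map e.measurable (by fun_prop)]
  unfold poisPi
  congr 1
  funext η
  refine Prod.ext rfl ?_
  ext k
  simp only [addD_apply]
  change η k + _ = _
  split_ifs <;> rfl

lemma cyl_measurable (φ : ConfN × ConfN → ℝ) (hφ : IsBddCylinder φ) : Measurable φ := by
  obtain ⟨⟨s, hs⟩, -⟩ := hφ
  let R : ConfN × ConfN → (s → ℕ × ℕ) := fun x i => (x.1 i, x.2 i)
  let E : (s → ℕ × ℕ) → ConfN × ConfN := fun f =>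
    (fun i => if h : i ∈ s then (f ⟨i, h⟩).1 else 0, fun i => if h : i ∈ s then (f ⟨i, h⟩).2 else 0)
  have hR : Measurable R := by
    refine measurable_pi_lambda _ fun i => ?_
    exact ((measurable_pi_apply _).comp measurable_fst).prodMk
      ((measurable_pi_apply _).comp measurable_snd)
  have : φ = (fun f => φ (E f)) ∘ R := by
    funext x
    refine hs _ _ fun i hi => ?_
    simp [E, R, hi]
  rw [this]
  exact (measurable_of_countable _).comp hR

lemma shift_sum (a : ℤ → ℝ) (c : ℝ) (s S : Finset ℤ) (d : ℤ) (ha : ∀ i ∉ s, a i = c)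
    (hS : ∀ i ∉ S, i ∉ s ∧ i + d ∉ s) : ∑ i ∈ S, (a (i + d) - a i) = 0 := by
  have hb : Summable fun i => a i - c :=
    summable_of_ne_finset_zero (s := s) fun i hi => by simp [ha i hi]
  have hb' : Summable fun i => a (i + d) - c := (Equiv.addRight d).summable_iff.2 hb
  have h1 : ∑' i, (a (i + d) - c) = ∑' i, (a i - c) :=
    (Equiv.addRight d).tsum_eq fun i => a i - c
  have h2 : ∑ i ∈ S, (a (i + d) - a i) = ∑' i, ((a (i + d) - c) - (a i - c)) := by
    rw [tsum_eq_sum (s := S)]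
    · exact Finset.sum_congr rfl fun i _ => by ring
    · intro i hi
      rw [ha i (hS i hi).1, ha _ (hS i hi).2]; simp
  rw [h2, hb'.tsum_sub hb, h1, sub_self]

/-- Case (i) of Theorem 1: independent walkers. For `g(y) = 𝔞·y`, `0 < p ≤ 1`, `θ = σ` and
`μ̂ = μ^θ`, the single-shock measure satisfies the random walking shock property with rates
`P = p·𝔞` and `Q = (1-p)·𝔞`. -/
theorem rws_independent_walkers
    (𝔞 p θ : ℝ) (h𝔞 : 0 < 𝔞) (hp0 : 0 < p) (hp1 : p ≤ 1)
    (g : ℕ → ℝ) (hg : ∀ y : ℕ, g y = 𝔞 * y)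
    (ν : ℤ → Measure (ConfN × ConfN))
    (hν : ∀ j : ℤ, IsProductMeasure (shockFactor g θ θ (muN g θ) j) (ν j))
    (j : ℤ) (φ : ConfN × ConfN → ℝ) (hφ : IsBddCylinder φ) :
    ∫ x, LN p g φ x ∂(ν j)
      = p * 𝔞 * ((∫ x, φ x ∂(ν (j + 1))) - ∫ x, φ x ∂(ν j))
        + (1 - p) * 𝔞 * ((∫ x, φ x ∂(ν (j - 1))) - ∫ x, φ x ∂(ν j)) := by
  obtain ⟨r, hr⟩ : ∃ r : NNReal, (r : ℝ) = exp θ / 𝔞 := ⟨⟨exp θ / 𝔞, by positivity⟩, rfl⟩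
  have hφm := cyl_measurable φ hφ
  obtain ⟨⟨s, hs⟩, C, hC⟩ := hφ
  have hνe := fun k => nu_eq 𝔞 θ h𝔞 g hg r hr k (ν k) (hν k)
  have hpm : ∀ k, Measurable fun η : ConfN => (η, addD η k) := fun k =>
    measurable_id.prodMk (measurable_addD k)
  have hint : ∀ k, ∫ x, φ x ∂(ν k) = ∫ η, φ (η, addD η k) ∂(poisPi r) := by
    intro k
    rw [hνe k, integral_map (hpm k).aemeasurable hφm.aestronglyMeasurable]
  -- the finite set of relevant sites
  obtain ⟨S, hSj, hS0, hS1, hS2⟩ : ∃ S : Finset ℤ, j ∈ S ∧ (∀ i ∉ S, i ∉ s) ∧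
      (∀ i ∉ S, i + 1 ∉ s) ∧ (∀ i ∉ S, i - 1 ∉ s) := by
    refine ⟨insert j (s ∪ s.image (· - 1) ∪ s.image (· + 1)), by simp, ?_, ?_, ?_⟩ <;>
    · intro i hi h
      apply hi
      simp only [Finset.mem_insert, Finset.mem_union, Finset.mem_image]
      first
        | exact Or.inr (Or.inl (Or.inl h))
        | exact Or.inr (Or.inl (Or.inr ⟨i + 1, h, by omega⟩))
        | exact Or.inr (Or.inr ⟨i - 1, h, by omega⟩)
  have hmv : ∀ (η : ConfN) (i k l : ℤ), l ≠ i → l ≠ k → moveN η i k l = η l := by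
    intro η i k l h1 h2; simp [moveN, h1, h2]
  have hLN : ∀ x, LN p g φ x = ∑ i ∈ S,
    (p * g (x.1 i) * (φ (moveN x.1 i (i + 1), moveN x.2 i (i + 1)) - φ x)
      + p * (g (x.2 i) - g (x.1 i)) * (φ (x.1, moveN x.2 i (i + 1)) - φ x)
      + (1 - p) * g (x.1 i) * (φ (moveN x.1 i (i - 1), moveN x.2 i (i - 1)) - φ x)
      + (1 - p) * (g (x.2 i) - g (x.1 i)) * (φ (x.1, moveN x.2 i (i - 1)) - φ x)) := by
    intro x
    unfold LN
    refine tsum_eq_sum fun i hi => ?_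
    have hne : ∀ l ∈ s, l ≠ i ∧ l ≠ i + 1 ∧ l ≠ i - 1 := fun l hl =>
      ⟨fun h => hS0 i hi (h ▸ hl), fun h => hS1 i hi (h ▸ hl), fun h => hS2 i hi (h ▸ hl)⟩
    have e1 : φ (moveN x.1 i (i + 1), moveN x.2 i (i + 1)) = φ x := hs _ _ fun l hl =>
      ⟨hmv _ _ _ _ (hne l hl).1 (hne l hl).2.1, hmv _ _ _ _ (hne l hl).1 (hne l hl).2.1⟩
    have e2 : φ (x.1, moveN x.2 i (i + 1)) = φ x := hs _ _ fun l hl =>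
      ⟨rfl, hmv _ _ _ _ (hne l hl).1 (hne l hl).2.1⟩
    have e3 : φ (moveN x.1 i (i - 1), moveN x.2 i (i - 1)) = φ x := hs _ _ fun l hl =>
      ⟨hmv _ _ _ _ (hne l hl).1 (hne l hl).2.2, hmv _ _ _ _ (hne l hl).1 (hne l hl).2.2⟩
    have e4 : φ (x.1, moveN x.2 i (i - 1)) = φ x := hs _ _ fun l hl =>
      ⟨rfl, hmv _ _ _ _ (hne l hl).1 (hne l hl).2.2⟩
    rw [e1, e2, e3, e4]; ring
  have hgm : Measurable g := measurable_of_countable g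
  have hg1 : ∀ i : ℤ, Measurable fun x : ConfN × ConfN => g (x.1 i) := fun i =>
    hgm.comp ((measurable_pi_apply i).comp measurable_fst)
  have hg2 : ∀ i : ℤ, Measurable fun x : ConfN × ConfN => g (x.2 i) := fun i =>
    hgm.comp ((measurable_pi_apply i).comp measurable_snd)
  have hm1 : ∀ i k : ℤ, Measurable fun x : ConfN × ConfN => φ (moveN x.1 i k, moveN x.2 i k) :=
    fun i k => hφm.comp (((measurable_moveN i k).comp measurable_fst).prodMk
      ((measurable_moveN i k).comp measurable_snd))
  have hm2 : ∀ i k : ℤ, Measurable fun x : ConfN × ConfN => φ (x.1, moveN x.2 i k) :=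
    fun i k => hφm.comp (measurable_fst.prodMk ((measurable_moveN i k).comp measurable_snd))
  have hLm : Measurable (LN p g φ) := by
    rw [funext hLN]
    refine Finset.measurable_sum S fun i _ => ?_
    have a1 := hg1 i
    have a2 := hg2 i
    have a3 := hm1 i (i + 1)
    have a4 := hm1 i (i - 1)
    have a5 := hm2 i (i + 1)
    have a6 := hm2 i (i - 1)
    exact ((((a1.const_mul p).mul (a3.sub hφm)).add
      (((a2.sub a1).const_mul p).mul (a5.sub hφm))).add
      ((a1.const_mul (1 - p)).mul (a4.sub hφm))).add
      (((a2.sub a1).const_mul (1 - p)).mul (a6.sub hφm))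
  rw [hνe j, integral_map (hpm j).aemeasurable hLm.aestronglyMeasurable, ← hνe j]
  set ψ : ConfN → ℝ := fun η => φ (η, addD η j) with hψ
  have hψm : Measurable ψ := hφm.comp (hpm j)
  let G : ℤ → ℤ → ConfN → ℝ := fun i k η =>
    φ (moveN η i k, moveN (addD η j) i k) - ψ η
  have hGm : ∀ i k, Measurable (G i k) := fun i k => ((hm1 i k).comp (hpm j)).sub hψm
  have hGb : ∀ i k η, |G i k η| ≤ C + C := fun i k η =>
    (abs_sub _ _).trans (add_le_add (hC _) (hC _))
  have hGa : ∀ i k η, k ≠ i → G i k (addD η i) = ψ (addD η k) - ψ (addD η i) := by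
    intro i k η h
    simp only [G, hψ]
    rw [addD_comm η i j, moveN_addD _ _ _ h, moveN_addD _ _ _ h, addD_comm η k j]
  let H : ℤ → ConfN → ℝ := fun k η => φ (η, addD η k) - ψ η
  have hpt : ∀ η, LN p g φ (η, addD η j) =
      (∑ i ∈ S, (p * 𝔞 * ((η i : ℝ) * G i (i + 1) η) + (1 - p) * 𝔞 * ((η i : ℝ) * G i (i - 1) η)))
      + (p * 𝔞 * H (j + 1) η + (1 - p) * 𝔞 * H (j - 1) η) := by
    intro η
    rw [hLN]
    have : p * 𝔞 * H (j + 1) η + (1 - p) * 𝔞 * H (j - 1) η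
        = ∑ i ∈ S, if i = j then p * 𝔞 * H (j + 1) η + (1 - p) * 𝔞 * H (j - 1) η else 0 := by
      rw [Finset.sum_ite_eq' S j, if_pos hSj]
    rw [this, ← Finset.sum_add_distrib]
    refine Finset.sum_congr rfl fun i _ => ?_
    simp only [hg]
    by_cases h : i = j
    · subst h
      rw [if_pos rfl]
      simp only [G, H, hψ, moveN_addD η i (i + 1) (by omega), moveN_addD η i (i - 1) (by omega)]
      rw [addD_apply, if_pos rfl]
      push_cast
      ring
    · rw [if_neg h, addD_apply, if_neg h]
      simp only [G, hψ]
      ring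
  have bint : ∀ F : ConfN → ℝ, Measurable F → (∃ D, ∀ η, |F η| ≤ D) → Integrable F (poisPi r) := by
    rintro F hF ⟨D, hD⟩
    exact Integrable.of_bound hF.aestronglyMeasurable D (.of_forall hD)
  have iψ : ∀ k, Integrable (fun η => φ (η, addD η k)) (poisPi r) := fun k =>
    bint _ (hφm.comp (hpm k)) ⟨C, fun η => hC _⟩
  have iψa : ∀ k, Integrable (fun η => ψ (addD η k)) (poisPi r) := fun k =>
    bint _ (hψm.comp (measurable_addD k)) ⟨C, fun η => hC _⟩
  have iG : ∀ i k, Integrable (fun η => (η i : ℝ) * G i k η) (poisPi r) := fun i k =>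
    mecke_integrable r i _ (hGm i k) _ (hGb i k)
  have iH : ∀ k, Integrable (H k) (poisPi r) := fun k => (iψ k).sub (iψ j)
  have intH : ∀ k, ∫ η, H k η ∂(poisPi r) = (∫ x, φ x ∂(ν k)) - ∫ x, φ x ∂(ν j) := by
    intro k
    rw [hint, hint, ← integral_sub (iψ k) (iψ j)]
  let a : ℤ → ℝ := fun k => ∫ η, ψ (addD η k) ∂(poisPi r)
  have intG : ∀ i k, k ≠ i → ∫ η, (η i : ℝ) * G i k η ∂(poisPi r) = r * (a k - a i) := by
    intro i k h
    rw [mecke_integral r i _ (hGm i k)]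
    simp only [hGa i k _ h]
    rw [integral_sub (iψa k) (iψa i)]
  have ha : ∀ i ∉ s, a i = ∫ η, ψ η ∂(poisPi r) := by
    intro i hi
    refine integral_congr_ae (.of_forall fun η => ?_)
    refine hs _ _ fun l hl => ?_
    have hli : l ≠ i := fun h => hi (h ▸ hl)
    simp [addD_apply, hli]
  have t1 := shift_sum a _ s S 1 ha fun i hi => ⟨hS0 i hi, hS1 i hi⟩
  have t2 := shift_sum a _ s S (-1) ha fun i hi => ⟨hS0 i hi, hS2 i hi⟩
  simp only [hpt]
  rw [integral_add, integral_add, integral_finsetSum, integral_const_mul, integral_const_mul,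
    intH, intH]
  · have : ∑ i ∈ S, ∫ η, (p * 𝔞 * ((η i : ℝ) * G i (i + 1) η)
        + (1 - p) * 𝔞 * ((η i : ℝ) * G i (i - 1) η)) ∂(poisPi r)
        = p * 𝔞 * r * ∑ i ∈ S, (a (i + 1) - a i)
          + (1 - p) * 𝔞 * r * ∑ i ∈ S, (a (i + -1) - a i) := by
      rw [Finset.mul_sum, Finset.mul_sum, ← Finset.sum_add_distrib]
      refine Finset.sum_congr rfl fun i _ => ?_
      rw [integral_add ((iG _ _).const_mul _) ((iG _ _).const_mul _), integral_const_mul,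
        integral_const_mul, intG _ _ (by omega), intG _ _ (by omega), ← sub_eq_add_neg]
      ring
    rw [this, t1, t2]
    ring
  · exact fun i _ => ((iG _ _).const_mul _).add ((iG _ _).const_mul _)
  · exact (iH _).const_mul _
  · exact (iH _).const_mul _
  · exact integrable_finsetSum _ fun i _ => ((iG _ _).const_mul _).add ((iG _ _).const_mul _)
  · exact ((iH _).const_mul _).add ((iH _).const_mul _)
end

section
/- Let g(y) = 𝔞·e^{βy} + 𝔟 on ℤ with 𝔞, β > 0 and 𝔟 ≥ 0 (the generalised exponential zero range process with doubly infinite occupation numbers), let p = 1, let θ, σ be real numbers with ln 𝔟 < σ = θ − β (so Z(θ), Z(σ) < ∞), and let μ̂ = μ^σ. Then the single-shock measure ν_j satisfies the random walking shock property with rates P = (e^{β} − 1)·(e^σ − 𝔟) and Q = 0, i.e. for every bounded cylinder function φ, ∫Lφ dν_j = (e^β − 1)(e^σ − 𝔟)·(∫φ dν_{j+1} − ∫φ dν_j). -/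
open MeasureTheory Real

noncomputable def gfactZ (g : ℤ → ℝ) (z : ℤ) : ℝ :=
  if 0 ≤ z then ∏ y ∈ Finset.Icc 1 z, g y else (∏ y ∈ Finset.Icc (z + 1) 0, g y)⁻¹

noncomputable def ZZ (g : ℤ → ℝ) (θ : ℝ) : ℝ := ∑' z : ℤ, exp (θ * z) / gfactZ g z

noncomputable def muZ (g : ℤ → ℝ) (θ : ℝ) (z : ℤ) : ℝ := exp (θ * z) / (gfactZ g z * ZZ g θ)

abbrev ConfZ : Type := ℤ → ℤ

/-- The configuration with one particle moved from site `i` to site `j`. -/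
def moveZ (η : ConfZ) (i j : ℤ) : ConfZ :=
  fun k => if k = i then η k - 1 else if k = j then η k + 1 else η k

/-- The coupled totally asymmetric (`p = 1`) zero range generator with rate function `g`. -/
noncomputable def LZ (g : ℤ → ℝ) (φ : ConfZ × ConfZ → ℝ) (x : ConfZ × ConfZ) : ℝ :=
  ∑' i : ℤ,
    (g (x.1 i) * (φ (moveZ x.1 i (i + 1), moveZ x.2 i (i + 1)) - φ x)
      + (g (x.2 i) - g (x.1 i)) * (φ (x.1, moveZ x.2 i (i + 1)) - φ x))

/-- A bounded cylinder function: bounded and depending on finitely many coordinates. -/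
def IsBddCylinderZ (φ : ConfZ × ConfZ → ℝ) : Prop :=
  (∃ s : Finset ℤ, ∀ x y : ConfZ × ConfZ,
      (∀ i ∈ s, x.1 i = y.1 i ∧ x.2 i = y.2 i) → φ x = φ y)
    ∧ ∃ C : ℝ, ∀ x, |φ x| ≤ C

/-- The discrete measure on ℤ × ℤ with mass function `f`. -/
noncomputable def siteMeasureZ (f : ℤ × ℤ → ℝ) : Measure (ℤ × ℤ) :=
  Measure.count.withDensity fun yz => ENNReal.ofReal (f yz)

/-- `ν` is the product measure on `(ℤ × ℤ)^ℤ` with the given site marginals: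
every cylinder event has product probability. -/
def IsProductMeasureZ (fac : ℤ → Measure (ℤ × ℤ)) (ν : Measure (ConfZ × ConfZ)) : Prop :=
  ∀ (s : Finset ℤ) (B : ℤ → Set (ℤ × ℤ)),
    ν {x : ConfZ × ConfZ | ∀ i ∈ s, (x.1 i, x.2 i) ∈ B i} = ∏ i ∈ s, fac i (B i)

/-- The site marginals of the single-shock measure `ν_j`. -/
noncomputable def shockFactorZ (g : ℤ → ℝ) (θ σ : ℝ) (μhat : ℤ → ℝ) (j i : ℤ) :
    Measure (ℤ × ℤ) :=
  if i < j then siteMeasureZ fun yz => if yz.2 = yz.1 then muZ g θ yz.1 else 0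
  else if i = j then siteMeasureZ fun yz => if yz.2 = yz.1 + 1 then μhat yz.1 else 0
  else siteMeasureZ fun yz => if yz.2 = yz.1 then muZ g σ yz.1 else 0


lemma gfactZ_succ (g : ℤ → ℝ) (hg : ∀ y, 0 < g y) (z : ℤ) :
    gfactZ g (z + 1) = g (z + 1) * gfactZ g z := by
  unfold gfactZ
  rcases lt_trichotomy z (-1) with h | h | h
  · have e : Finset.Icc (z + 1) 0 = insert (z + 1) (Finset.Icc (z + 1 + 1) 0) := by
      ext k; simp only [Finset.mem_Icc, Finset.mem_insert]; omega
    rw [if_neg (by omega), if_neg (by omega), e, Finset.prod_insert (by simp)]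
    have := (hg (z + 1)).ne'
    rw [mul_inv, ← mul_assoc, mul_inv_cancel₀ this, one_mul]
  · subst h
    simp [(hg 0).ne']
  · have e : Finset.Icc 1 (z + 1) = insert (z + 1) (Finset.Icc 1 z) := by
      ext k; simp only [Finset.mem_Icc, Finset.mem_insert]; omega
    rw [if_pos (by omega), if_pos (by omega), e, Finset.prod_insert (by simp)]

lemma gfactZ_pos (g : ℤ → ℝ) (hg : ∀ y, 0 < g y) (z : ℤ) : 0 < gfactZ g z := by
  unfold gfactZ
  split_ifs
  · exact Finset.prod_pos fun y _ => hg y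
  · exact inv_pos.mpr (Finset.prod_pos fun y _ => hg y)

lemma muZ_succ (g : ℤ → ℝ) (hg : ∀ y, 0 < g y) (θ : ℝ) (z : ℤ) :
    g (z + 1) / exp θ * muZ g θ (z + 1) = muZ g θ z := by
  unfold muZ
  rw [gfactZ_succ g hg]
  have h1 := (hg (z + 1)).ne'
  have h2 := (gfactZ_pos g hg z).ne'
  have h3 := (exp_pos θ).ne'
  push_cast
  rw [mul_add, mul_one, exp_add]
  by_cases h : ZZ g θ = 0
  · simp [h]
  · field_simp

lemma ZZ_rel (𝔞 β 𝔟 θ σ : ℝ) (h𝔞 : 0 < 𝔞) (h𝔟 : 0 ≤ 𝔟)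
    (hσ : σ = θ - β) 
    (g : ℤ → ℝ) (hg : ∀ y : ℤ, g y = 𝔞 * exp (β * y) + 𝔟)
    (h : ZZ g σ ≠ 0) : 𝔞 * ZZ g θ = (exp σ - 𝔟) * ZZ g σ := by
  have hpos : ∀ y, 0 < g y := fun y => by rw [hg]; positivity
  have hs : Summable fun z : ℤ => exp (σ * z) / gfactZ g z := by
    by_contra hn
    exact h (tsum_eq_zero_of_not_summable hn)
  have hH : HasSum (fun z : ℤ => exp (σ * z) / gfactZ g z) (ZZ g σ) := hs.hasSum
  have h1 : HasSum (fun z : ℤ => g z * (exp (σ * z) / gfactZ g z)) (exp σ * ZZ g σ) := by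
    rw [← (Equiv.addRight (1 : ℤ)).hasSum_iff]
    have hm := hH.mul_left (exp σ)
    refine Eq.mp (congrArg (fun f : ℤ → ℝ => HasSum f (exp σ * ZZ g σ)) (funext fun z => ?_)) hm
    symm
    change g (z + 1) * (exp (σ * ((z + 1 : ℤ) : ℝ)) / gfactZ g (z + 1)) = _
    rw [gfactZ_succ g hpos]
    have h1 := (hpos (z + 1)).ne'
    have h2 := (gfactZ_pos g hpos z).ne'
    push_cast
    rw [mul_add, mul_one, exp_add]
    field_simp
  have h2 := h1.sub (hH.mul_left 𝔟)
  unfold ZZ at *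
  rw [← tsum_mul_left, sub_mul, ← h2.tsum_eq]
  congr 1; ext z
  rw [hg, show θ = σ + β by linarith, add_mul, exp_add]
  ring

lemma muZ_rel (𝔞 β 𝔟 θ σ : ℝ) (h𝔞 : 0 < 𝔞) (h𝔟 : 0 ≤ 𝔟)
    (hσ : σ = θ - β) (hσb : 𝔟 < exp σ)
    (g : ℤ → ℝ) (hg : ∀ y : ℤ, g y = 𝔞 * exp (β * y) + 𝔟)
    (h : ZZ g σ ≠ 0) (z : ℤ) :
    (g z - 𝔟) / (exp σ - 𝔟) * muZ g σ z = muZ g θ z := by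
  have hpos : ∀ y, 0 < g y := fun y => by rw [hg]; positivity
  have hr := ZZ_rel 𝔞 β 𝔟 θ σ h𝔞 h𝔟 hσ g hg h
  have h2 := (gfactZ_pos g hpos z).ne'
  have h3 : exp σ - 𝔟 ≠ 0 := by linarith
  have h4 : ZZ g θ ≠ 0 := by
    intro h0
    rw [h0, mul_zero] at hr
    exact mul_ne_zero h3 h hr.symm
  unfold muZ
  rw [hg, show exp (θ * z) = exp (σ * z) * exp (β * z) by rw [← exp_add]; congr 1; rw [hσ]; ring]
  rw [div_mul_div_comm, div_eq_div_iff (by positivity) (by positivity)]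
  linear_combination (exp (σ * z) * exp (β * z) * gfactZ g z) * hr

lemma telesZ (G : ℤ → ℝ) (a b : ℤ) (hab : a ≤ b) :
    ∑ i ∈ Finset.Ico a b, (G (i + 1) - G i) = G b - G a := by
  induction b, hab using Int.leInduction with
  | base => simp
  | succ b hb ih =>
    have e : Finset.Ico a (b + 1) = insert b (Finset.Ico a b) := by
      ext k; simp only [Finset.mem_Ico, Finset.mem_insert]; omega
    rw [e, Finset.sum_insert (by simp), ih]; ring

lemma uniqZ (fac : ℤ → Measure (ℤ × ℤ)) [∀ i, IsProbabilityMeasure (fac i)]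
    (ν ν' : Measure (ConfZ × ConfZ)) (h : IsProductMeasureZ fac ν)
    (h' : IsProductMeasureZ fac ν') : ν = ν' := by
  let e : (ConfZ × ConfZ) ≃ᵐ (ℤ → ℤ × ℤ) :=
    { toFun := fun x k => (x.1 k, x.2 k)
      invFun := fun y => (fun k => (y k).1, fun k => (y k).2)
      left_inv := fun x => rfl
      right_inv := fun y => rfl
      measurable_toFun := by simp only [Equiv.coe_fn_mk]; fun_prop
      measurable_invFun := by simp only [Equiv.coe_fn_symm_mk]; fun_prop }
  have key : ∀ ν : Measure (ConfZ × ConfZ), IsProductMeasureZ fac ν →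
      ν.map e = Measure.infinitePi fac := by
    intro ν h
    apply Measure.eq_infinitePi
    intro s t ht
    rw [e.map_apply, ← h s t]
    rfl
  have := (key ν h).trans (key ν' h').symm
  have h2 := congrArg (Measure.map e.symm) this
  simpa using h2

def trZ (v : ℤ → ℤ × ℤ) (x : ConfZ × ConfZ) : ConfZ × ConfZ :=
  (fun k => x.1 k + (v k).1, fun k => x.2 k + (v k).2)

lemma trZ_meas (v : ℤ → ℤ × ℤ) : Measurable (trZ v) := by
  unfold trZ; fun_prop

lemma cyl_meas (φ : ConfZ × ConfZ → ℝ) (hφ : IsBddCylinderZ φ) : Measurable φ := by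
  obtain ⟨⟨s, hs⟩, -⟩ := hφ
  let r : ConfZ × ConfZ → (s → ℤ × ℤ) := fun x k => (x.1 k, x.2 k)
  let F : (s → ℤ × ℤ) → ConfZ × ConfZ := fun y =>
    (fun k => if h : k ∈ s then (y ⟨k, h⟩).1 else 0, fun k => if h : k ∈ s then (y ⟨k, h⟩).2 else 0)
  have h1 : φ = (fun y => φ (F y)) ∘ r := by
    ext x
    apply hs
    intro i hi
    simp [F, r, hi]
  rw [h1]
  exact (Measurable.of_discrete).comp (by fun_prop)

lemma boxZ_meas (s : Finset ℤ) (B : ℤ → Set (ℤ × ℤ)) :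
    MeasurableSet {x : ConfZ × ConfZ | ∀ i ∈ s, (x.1 i, x.2 i) ∈ B i} := by
  have : {x : ConfZ × ConfZ | ∀ i ∈ s, (x.1 i, x.2 i) ∈ B i}
      = ⋂ i ∈ s, (fun x : ConfZ × ConfZ => (x.1 i, x.2 i)) ⁻¹' (B i) := by ext; simp
  rw [this]
  refine Finset.measurableSet_biInter _ fun i _ => ?_
  exact MeasurableSet.preimage (MeasurableSet.of_discrete) (by fun_prop)

lemma keyZ (fac fac' : ℤ → Measure (ℤ × ℤ)) (ν : Measure (ConfZ × ConfZ))
    [∀ i, IsProbabilityMeasure (fac' i)]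
    (hν : IsProductMeasureZ fac ν) (i : ℤ) (h : ℤ × ℤ → ENNReal) (v : ℤ → ℤ × ℤ)
    (hi : ∀ B, fac' i B = ((fac i).withDensity h) {y | y + v i ∈ B})
    (hk : ∀ k, k ≠ i → ∀ B, fac' k B = fac k {y | y + v k ∈ B}) :
    IsProductMeasureZ fac' ((ν.withDensity fun x => h (x.1 i, x.2 i)).map (trZ v)) := by
  have hπ : Measurable (fun x : ConfZ × ConfZ => (x.1 i, x.2 i)) := by fun_prop
  -- first for sets containing i
  have main : ∀ (s : Finset ℤ) (B : ℤ → Set (ℤ × ℤ)), i ∉ s →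
      ((ν.withDensity fun x => h (x.1 i, x.2 i)).map (trZ v))
        {x : ConfZ × ConfZ | ∀ k ∈ insert i s, (x.1 k, x.2 k) ∈ B k}
        = ∏ k ∈ insert i s, fac' k (B k) := by
    intro s B his
    rw [Measure.map_apply (trZ_meas v) (boxZ_meas _ _)]
    let B' : ℤ → Set (ℤ × ℤ) := fun k => {y | y + v k ∈ B k}
    let R : Set (ConfZ × ConfZ) := {x | ∀ k ∈ s, (x.1 k, x.2 k) ∈ B' k}
    have hR : MeasurableSet R := boxZ_meas _ _
    have e1 : trZ v ⁻¹' {x : ConfZ × ConfZ | ∀ k ∈ insert i s, (x.1 k, x.2 k) ∈ B k}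
        = (fun x : ConfZ × ConfZ => (x.1 i, x.2 i)) ⁻¹' (B' i) ∩ R := by
      ext x
      simp only [trZ, B', R, Set.mem_preimage, Set.mem_inter_iff, Set.mem_ofPred_eq,
        Finset.forall_mem_insert]
      rfl
    have hm : (ν.restrict R).map (fun x : ConfZ × ConfZ => (x.1 i, x.2 i))
        = (∏ k ∈ s, fac k (B' k)) • fac i := by
      ext C hC
      rw [Measure.map_apply hπ hC, Measure.restrict_apply (hπ hC)]
      have := hν (insert i s) (Function.update B' i C)
      rw [Finset.prod_insert his] at this
      rw [Measure.smul_apply, smul_eq_mul, mul_comm]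
      convert this using 2
      · ext x
        simp only [Set.mem_inter_iff, Set.mem_preimage, Finset.forall_mem_insert, R,
          Function.update_self, Set.mem_ofPred_eq]
        refine and_congr Iff.rfl (forall₂_congr fun k hks => ?_)
        rw [Function.update_of_ne (ne_of_mem_of_not_mem hks his)]
      · simp
      · refine Finset.prod_congr rfl fun k hks => ?_
        rw [Function.update_of_ne (ne_of_mem_of_not_mem hks his)]
    have hmeas : Measurable h := Measurable.of_discrete
    have hB : MeasurableSet (B' i) := MeasurableSet.of_discrete
    rw [e1, withDensity_apply _ ((hπ hB).inter hR), ← Measure.restrict_restrict (hπ hB),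
      ← setLIntegral_map hB hmeas hπ, hm, Measure.restrict_smul, lintegral_smul_measure,
      Finset.prod_insert his, hi, withDensity_apply _ hB, smul_eq_mul, mul_comm]
    congr 1
    refine Finset.prod_congr rfl fun k hks => ?_
    rw [hk k (ne_of_mem_of_not_mem hks his)]
  intro s B
  by_cases his : i ∈ s
  · have := main (s.erase i) B (by simp)
    rwa [Finset.insert_erase his] at this
  · have := main s (Function.update B i Set.univ) his
    rw [Finset.prod_insert his] at this
    simp only [Function.update_self, measure_univ, one_mul, Finset.forall_mem_insert,
      Set.mem_univ, true_and] at this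
    convert this using 2
    · ext x
      refine forall₂_congr fun k hks => ?_
      rw [Function.update_of_ne (ne_of_mem_of_not_mem hks his)]
    · rw [Function.update_of_ne (ne_of_mem_of_not_mem ‹_ ∈ s› his)]

lemma keyIntZ (fac fac' : ℤ → Measure (ℤ × ℤ)) (ν ν' : Measure (ConfZ × ConfZ))
    [∀ i, IsProbabilityMeasure (fac' i)]
    (hν : IsProductMeasureZ fac ν) (hν' : IsProductMeasureZ fac' ν')
    (i : ℤ) (h : ℤ → ℝ) (h0 : ∀ y, 0 ≤ h y) (v : ℤ → ℤ × ℤ)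
    (hi : ∀ B, fac' i B = ((fac i).withDensity fun y => ENNReal.ofReal (h y.1)) {y | y + v i ∈ B})
    (hk : ∀ k, k ≠ i → ∀ B, fac' k B = fac k {y | y + v k ∈ B})
    (φ : ConfZ × ConfZ → ℝ) (hφ : Measurable φ) :
    ∫ x, h (x.1 i) * φ (trZ v x) ∂ν = ∫ x, φ x ∂ν' := by
  have h1 := keyZ fac fac' ν hν i _ v hi hk
  rw [uniqZ fac' ν' _ hν' h1, integral_map (trZ_meas v).aemeasurable hφ.aestronglyMeasurable,
    integral_withDensity_eq_integral_toReal_smul]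
  · simp [h0]
  · have : Measurable fun y : ℤ => ENNReal.ofReal (h y) := Measurable.of_discrete
    exact this.comp (by fun_prop)
  · simp

lemma siteZ (f f' : ℤ × ℤ → ℝ) (h : ℤ → ℝ) (h0 : ∀ y, 0 ≤ h y) (v : ℤ × ℤ)
    (hf : ∀ y, f' (y + v) = h y.1 * f y) (B : Set (ℤ × ℤ)) :
    siteMeasureZ f' B
      = ((siteMeasureZ f).withDensity fun y => ENNReal.ofReal (h y.1)) {y | y + v ∈ B} := by
  have hB : MeasurableSet B := MeasurableSet.of_discrete
  have hB' : MeasurableSet {y | y + v ∈ B} := MeasurableSet.of_discrete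
  unfold siteMeasureZ
  rw [← withDensity_mul _ Measurable.of_discrete Measurable.of_discrete,
    withDensity_apply _ hB, withDensity_apply _ hB', ← lintegral_indicator hB,
    ← lintegral_indicator hB', lintegral_count, lintegral_count,
    ← (Equiv.addRight v).tsum_eq]
  congr 1; ext y
  change B.indicator _ (y + v) = _
  by_cases hy : y + v ∈ B
  · have hy' : y ∈ {y | y + v ∈ B} := hy
    rw [Set.indicator_of_mem hy, Set.indicator_of_mem hy', hf, ENNReal.ofReal_mul (h0 _), mul_comm]
    rfl
  · have hy' : y ∉ {y | y + v ∈ B} := hy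
    rw [Set.indicator_of_notMem hy, Set.indicator_of_notMem hy']

lemma siteZ' (f f' : ℤ × ℤ → ℝ) (v : ℤ × ℤ)
    (hf : ∀ y, f' (y + v) = f y) (B : Set (ℤ × ℤ)) :
    siteMeasureZ f' B = siteMeasureZ f {y | y + v ∈ B} := by
  rw [siteZ f f' (fun _ => 1) (by simp) v (by simpa using hf)]
  simp

lemma siteZ_null (f : ℤ × ℤ → ℝ) (B : Set (ℤ × ℤ)) (hB : ∀ y ∈ B, f y = 0) :
    siteMeasureZ f B = 0 := by
  unfold siteMeasureZ
  rw [withDensity_apply _ MeasurableSet.of_discrete, ← lintegral_indicator MeasurableSet.of_discrete]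
  rw [lintegral_eq_zero_iff Measurable.of_discrete]
  refine Filter.Eventually.of_forall fun y => ?_
  by_cases h : y ∈ B
  · simp [h, hB y h]
  · simp [h]

/-- site mass functions of the shock measure -/
noncomputable def massZ (g : ℤ → ℝ) (θ σ : ℝ) (j i : ℤ) (yz : ℤ × ℤ) : ℝ :=
  if i < j then (if yz.2 = yz.1 then muZ g θ yz.1 else 0)
  else if i = j then (if yz.2 = yz.1 + 1 then muZ g σ yz.1 else 0)
  else (if yz.2 = yz.1 then muZ g σ yz.1 else 0)

lemma shock_eq (g : ℤ → ℝ) (θ σ : ℝ) (j i : ℤ) :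
    shockFactorZ g θ σ (muZ g σ) j i = siteMeasureZ (massZ g θ σ j i) := by
  unfold shockFactorZ massZ
  split_ifs <;> rfl

def unitZ (i : ℤ) (a b : ℤ) : ℤ → ℤ × ℤ := fun k => if k = i then (a, b) else 0

lemma move_eq (x : ConfZ × ConfZ) (i : ℤ) :
    (moveZ x.1 i (i + 1), moveZ x.2 i (i + 1))
      = trZ (unitZ (i + 1) 1 1) (trZ (unitZ i (-1) (-1)) x) := by
  ext k <;> simp only [moveZ, trZ, unitZ] <;> split_ifs <;> simp <;> omega

lemma tr_inv (x : ConfZ × ConfZ) (i : ℤ) :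
    trZ (unitZ i 1 1) (trZ (unitZ i (-1) (-1)) x) = x := by
  ext k <;> simp only [trZ, unitZ] <;> split_ifs <;> simp

lemma move2_eq (x : ConfZ × ConfZ) (i : ℤ) :
    (x.1, moveZ x.2 i (i + 1))
      = trZ (fun k => if k = i then (0, -1) else if k = i + 1 then (0, 1) else 0) x := by
  ext k <;> simp only [moveZ, trZ] <;> split_ifs <;> simp <;> omega

/-- Case (iv) of Theorem 1: the generalised exponential zero range process with doubly
infinite occupation numbers. For `g(y) = 𝔞·e^{βy} + 𝔟`, `p = 1`, `ln 𝔟 < σ = θ - β` and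
`μ̂ = μ^σ`, the single-shock measure satisfies the random walking shock property with rates
`P = (e^β - 1)·(e^σ - 𝔟)` and `Q = 0`. -/
theorem rws_generalised_exponential_ZRP
    (𝔞 β 𝔟 θ σ : ℝ) (h𝔞 : 0 < 𝔞) (hβ : 0 < β) (h𝔟 : 0 ≤ 𝔟)
    (hσ : σ = θ - β) (hσb : 𝔟 < exp σ)
    (g : ℤ → ℝ) (hg : ∀ y : ℤ, g y = 𝔞 * exp (β * y) + 𝔟)
    (ν : ℤ → Measure (ConfZ × ConfZ))
    (hν : ∀ j : ℤ, IsProductMeasureZ (shockFactorZ g θ σ (muZ g σ) j) (ν j))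
    (j : ℤ) (φ : ConfZ × ConfZ → ℝ) (hφ : IsBddCylinderZ φ) :
    ∫ x, LZ g φ x ∂(ν j)
      = (exp β - 1) * (exp σ - 𝔟) * ((∫ x, φ x ∂(ν (j + 1))) - ∫ x, φ x ∂(ν j)) := by
  have hpos : ∀ y, 0 < g y := fun y => by rw [hg]; positivity
  have hprob : ∀ j, IsProbabilityMeasure (ν j) := fun j => ⟨by
    have := hν j ∅ (fun _ => Set.univ)
    simpa using this⟩
  have hfprob : ∀ j i, IsProbabilityMeasure (shockFactorZ g θ σ (muZ g σ) j i) := fun j i => ⟨by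
    have := hν j {i} (fun _ => Set.univ)
    simpa using this.symm⟩
  have hZσ : ZZ g σ ≠ 0 := by
    intro h0
    have := (hfprob j j).measure_univ
    rw [shock_eq, siteZ_null] at this
    · exact zero_ne_one this
    · intro y _
      simp [massZ, muZ, h0]
  have hφm := cyl_meas φ hφ
  obtain ⟨⟨s, hs⟩, C, hC⟩ := hφ
  let c : ℤ → ℝ := fun i => if i < j then exp θ else exp σ
  have hc : ∀ i, 0 < c i := fun i => by simp only [c]; split_ifs <;> exact exp_pos _
  -- change of variables in a single site
  have T1 : ∀ (i : ℤ) (ψ : ConfZ × ConfZ → ℝ), Measurable ψ →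
      ∫ x, g (x.1 i) * ψ (trZ (unitZ i (-1) (-1)) x) ∂(ν j) = c i * ∫ x, ψ x ∂(ν j) := by
    intro i ψ hψ
    have := keyIntZ _ _ (ν j) (ν j) (hν j) (hν j) i (fun y => g y / c i)
      (fun y => (div_pos (hpos y) (hc i)).le) (unitZ i (-1) (-1)) ?_ ?_ ψ hψ
    · rw [← this, ← integral_const_mul]
      congr 1; ext x
      have := (hc i).ne'
      field_simp
    · intro B
      simp only [shock_eq]
      apply siteZ _ _ (fun y => g y / c i) (fun y => (div_pos (hpos y) (hc i)).le)
      rintro ⟨y, z⟩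
      have h1 := muZ_succ g hpos θ (y - 1)
      have h2 := muZ_succ g hpos σ (y - 1)
      simp only [sub_add_cancel] at h1 h2
      simp only [massZ, unitZ, c, if_true, Prod.mk_add_mk, ← sub_eq_add_neg]
      by_cases hij : i < j
      · simp only [hij, if_true]
        by_cases hzy : z = y
        · simp [hzy, h1]
        · simp [hzy]
      · simp only [hij, if_false]
        by_cases hij' : i = j
        · simp only [hij', if_true]
          by_cases hzy : z = y + 1
          · simp [hzy, h2]
          · rw [if_neg (by omega), if_neg hzy, mul_zero]
        · simp only [hij', if_false]
          by_cases hzy : z = y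
          · simp [hzy, h2]
          · simp [hzy]
    · intro k hk B
      simp [unitZ, hk]
  have T2 : ∀ (ψ : ConfZ × ConfZ → ℝ), Measurable ψ →
      ∫ x, (g (x.1 j) - 𝔟) * ψ (x.1, moveZ x.2 j (j + 1)) ∂(ν j)
        = (exp σ - 𝔟) * ∫ x, ψ x ∂(ν (j + 1)) := by
    intro ψ hψ
    have hb : 0 < exp σ - 𝔟 := by linarith
    have hh : ∀ y, 0 ≤ (g y - 𝔟) / (exp σ - 𝔟) := fun y => by
      apply div_nonneg _ hb.le
      rw [hg]; simp; positivity
    simp only [move2_eq]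
    rw [← keyIntZ _ _ (ν j) (ν (j + 1)) (hν j) (hν (j + 1)) j (fun y => (g y - 𝔟) / (exp σ - 𝔟))
      hh (fun k => if k = j then (0, -1) else if k = j + 1 then (0, 1) else 0) ?_ ?_ ψ hψ]
    · rw [← integral_const_mul]
      congr 1; ext x
      have := hb.ne'
      field_simp
    · intro B
      simp only [shock_eq]
      apply siteZ _ _ (fun y => (g y - 𝔟) / (exp σ - 𝔟)) hh
      rintro ⟨y, z⟩
      have h1 := muZ_rel 𝔞 β 𝔟 θ σ h𝔞 h𝔟 hσ hσb g hg hZσ y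
      simp only [massZ, if_true, Prod.mk_add_mk, add_zero, lt_irrefl, if_false]
      rw [if_pos (by omega)]
      by_cases hzy : z = y + 1
      · simp [hzy, h1]
      · rw [if_neg (by omega), if_neg hzy, mul_zero]
    · intro k hk B
      simp only [shock_eq]
      apply siteZ'
      rintro ⟨y, z⟩
      simp only [massZ, hk, if_false]
      by_cases hk1 : k = j + 1
      · subst hk1
        simp
      · by_cases hk2 : k < j
        · simp [hk2, hk1, show k < j + 1 by omega]
        · simp [hk2, hk1, show ¬ k < j + 1 by omega]
  have T2ψ := T2 φ hφm
  -- integrability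
  have hgint : ∀ i, Integrable (fun x : ConfZ × ConfZ => g (x.1 i)) (ν j) := by
    intro i
    by_contra hn
    have h1 := T1 i (fun _ => 1) measurable_const
    simp only [mul_one] at h1
    rw [integral_undef hn] at h1
    simp at h1
    exact (hc i).ne h1
  have hbd : ∀ (F : ConfZ × ConfZ → ConfZ × ConfZ), Measurable F → ∀ h : ConfZ × ConfZ → ℝ,
      Integrable h (ν j) → Integrable (fun x => h x * φ (F x)) (ν j) := by
    intro F hF h hh
    exact hh.mul_bdd (c := C) (hφm.comp hF).aestronglyMeasurable
      (Filter.Eventually.of_forall fun x => hC _)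
  have hmv : ∀ i, Measurable fun x : ConfZ × ConfZ => (moveZ x.1 i (i + 1), moveZ x.2 i (i + 1)) := by
    intro i
    simp only [move_eq]
    exact (trZ_meas _).comp (trZ_meas _)
  have hmv2 : ∀ i, Measurable fun x : ConfZ × ConfZ => (x.1, moveZ x.2 i (i + 1)) := by
    intro i
    simp only [move2_eq]
    exact trZ_meas _
  let A : ℤ → ℝ := fun k => ∫ x, φ (trZ (unitZ k 1 1) x) ∂(ν j)
  have I1 : ∀ i, ∫ x, g (x.1 i) * φ (moveZ x.1 i (i + 1), moveZ x.2 i (i + 1)) ∂(ν j)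
      = c i * A (i + 1) := by
    intro i
    simp only [move_eq]
    exact T1 i (fun x => φ (trZ (unitZ (i + 1) 1 1) x)) (hφm.comp (trZ_meas _))
  have I2 : ∀ i, ∫ x, g (x.1 i) * φ x ∂(ν j) = c i * A i := by
    intro i
    have := T1 i (fun x => φ (trZ (unitZ i 1 1) x)) (hφm.comp (trZ_meas _))
    simpa only [tr_inv] using this
  have hA : ∀ k, k ∉ s → A k = ∫ x, φ x ∂(ν j) := by
    intro k hk
    simp only [A]
    congr 1; ext x
    apply hs
    intro i hi
    have : i ≠ k := ne_of_mem_of_not_mem hi hk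
    simp [trZ, unitZ, this]
  -- almost sure relations
  have ae1 : ∀ i, i ≠ j → ∀ᵐ x ∂(ν j), x.2 i = x.1 i := by
    intro i hij
    have := hν j {i} (fun _ => {y | y.2 ≠ y.1})
    rw [Finset.prod_singleton, shock_eq, siteZ_null] at this
    · rw [ae_iff]
      simpa using this
    · rintro ⟨y, z⟩ hy
      have hy' : z ≠ y := hy
      simp [massZ, hij, hy']
  have ae2 : ∀ᵐ x ∂(ν j), x.2 j = x.1 j + 1 := by
    have := hν j {j} (fun _ => {y | y.2 ≠ y.1 + 1})
    rw [Finset.prod_singleton, shock_eq, siteZ_null] at this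
    · rw [ae_iff]
      simpa using this
    · rintro ⟨y, z⟩ hy
      have hy' : z ≠ y + 1 := hy
      simp [massZ, hy']
  have hgdiff : ∀ y : ℤ, g (y + 1) - g y = (exp β - 1) * (g y - 𝔟) := by
    intro y
    rw [hg, hg]; push_cast
    rw [mul_add, mul_one, exp_add]; ring
  let E2 : ℝ := (exp β - 1) * ((exp σ - 𝔟) * ∫ x, φ x ∂(ν (j + 1)))
    - (exp β - 1) * (exp σ * A j - 𝔟 * ∫ x, φ x ∂(ν j))
  let t : ℤ → ConfZ × ConfZ → ℝ := fun i x =>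
    (g (x.1 i) * (φ (moveZ x.1 i (i + 1), moveZ x.2 i (i + 1)) - φ x)
      + (g (x.2 i) - g (x.1 i)) * (φ (x.1, moveZ x.2 i (i + 1)) - φ x))
  have J1 : ∀ i, Integrable (fun x => g (x.1 i) * φ (moveZ x.1 i (i + 1), moveZ x.2 i (i + 1)))
      (ν j) := fun i => hbd _ (hmv i) _ (hgint i)
  have J2 : ∀ i, Integrable (fun x => g (x.1 i) * φ x) (ν j) :=
    fun i => hbd _ measurable_id _ (hgint i)
  have hgb : Integrable (fun x : ConfZ × ConfZ => g (x.1 j) - 𝔟) (ν j) :=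
    (hgint j).sub (integrable_const _)
  have J3 : Integrable (fun x => (g (x.1 j) - 𝔟) * φ (x.1, moveZ x.2 j (j + 1))) (ν j) :=
    hbd _ (hmv2 j) _ hgb
  have J4 : Integrable (fun x => (g (x.1 j) - 𝔟) * φ x) (ν j) :=
    hbd _ measurable_id _ hgb
  have J5 : Integrable φ (ν j) := by
    simpa using hbd _ measurable_id (fun _ => 1) (integrable_const _)
  have I4 : ∫ x, (g (x.1 j) - 𝔟) * φ x ∂(ν j) = exp σ * A j - 𝔟 * ∫ x, φ x ∂(ν j) := by
    have h1 := I2 j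
    simp only [c, lt_irrefl, if_false] at h1
    rw [← h1, ← integral_const_mul, ← integral_sub (J2 j) (J5.const_mul _)]
    congr 1; ext x; ring
  have ht : ∀ i, Integrable (t i) (ν j) ∧
      ∫ x, t i x ∂(ν j) = c i * A (i + 1) - c i * A i + if i = j then E2 else 0 := by
    intro i
    by_cases hij : i = j
    · subst hij
      have e : t i =ᵐ[ν i] fun x =>
          (g (x.1 i) * φ (moveZ x.1 i (i + 1), moveZ x.2 i (i + 1)) - g (x.1 i) * φ x)
          + ((exp β - 1) * ((g (x.1 i) - 𝔟) * φ (x.1, moveZ x.2 i (i + 1)))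
            - (exp β - 1) * ((g (x.1 i) - 𝔟) * φ x)) := by
        filter_upwards [ae2] with x hx
        simp only [t, hx, hgdiff]
        ring
      refine ⟨(((J1 i).sub (J2 i)).add ((J3.const_mul _).sub (J4.const_mul _))).congr e.symm, ?_⟩
      have K1 : Integrable (fun x => g (x.1 i) * φ (moveZ x.1 i (i + 1), moveZ x.2 i (i + 1))
          - g (x.1 i) * φ x) (ν i) := (J1 i).sub (J2 i)
      have K2 : Integrable (fun x =>
          (exp β - 1) * ((g (x.1 i) - 𝔟) * φ (x.1, moveZ x.2 i (i + 1)))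
            - (exp β - 1) * ((g (x.1 i) - 𝔟) * φ x)) (ν i) :=
        (J3.const_mul _).sub (J4.const_mul _)
      rw [integral_congr_ae e, integral_add K1 K2, integral_sub (J1 i) (J2 i),
        integral_sub (J3.const_mul _) (J4.const_mul _), integral_const_mul, integral_const_mul,
        I1, I2, T2ψ, I4, if_pos rfl]
    · have e : t i =ᵐ[ν j] fun x =>
          (g (x.1 i) * φ (moveZ x.1 i (i + 1), moveZ x.2 i (i + 1)) - g (x.1 i) * φ x) := by
        filter_upwards [ae1 i hij] with x hx
        simp only [t, hx]
        ring
      refine ⟨((J1 i).sub (J2 i)).congr e.symm, ?_⟩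
      rw [integral_congr_ae e, integral_sub (J1 i) (J2 i), I1, I2, if_neg hij, add_zero]
  obtain ⟨N, hN⟩ : ∃ N : ℤ, ∀ k ∈ insert j s, -N < k ∧ k < N := by
    refine ⟨∑ k ∈ insert j s, |k| + 1, fun k hk => ?_⟩
    have h1 : |k| ≤ ∑ k ∈ insert j s, |k| :=
      Finset.single_le_sum (f := fun k : ℤ => |k|) (fun _ _ => abs_nonneg _) hk
    rw [← abs_lt]; omega
  have hjN := hN j (Finset.mem_insert_self _ _)
  have hsN : ∀ k, (k ≤ -N ∨ N ≤ k) → k ∉ s := by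
    intro k hk hks
    have := hN k (Finset.mem_insert_of_mem hks)
    omega
  have hL : ∀ x, LZ g φ x = ∑ i ∈ Finset.Ico (-N) N, t i x := by
    intro x
    apply tsum_eq_sum
    intro i hi
    rw [Finset.mem_Ico] at hi
    have h1 : i ∉ s := hsN i (by omega)
    have h2 : i + 1 ∉ s := hsN (i + 1) (by omega)
    have e : ∀ η : ConfZ, ∀ k ∈ s, moveZ η i (i + 1) k = η k := by
      intro η k hk
      simp [moveZ, ne_of_mem_of_not_mem hk h1, ne_of_mem_of_not_mem hk h2]
    rw [hs (moveZ x.1 i (i + 1), moveZ x.2 i (i + 1)) x (fun k hk => ⟨e _ k hk, e _ k hk⟩),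
      hs (x.1, moveZ x.2 i (i + 1)) x (fun k hk => ⟨rfl, e _ k hk⟩)]
    ring
  simp only [hL]
  rw [integral_finsetSum _ fun i _ => (ht i).1]
  let G : ℤ → ℝ := fun i => if i ≤ j then exp θ * A i
    else exp σ * A i + (exp θ - exp σ) * A j + E2
  have hG : ∀ i, ∫ x, t i x ∂(ν j) = G (i + 1) - G i := by
    intro i
    rw [(ht i).2]
    simp only [G, c]
    rcases lt_trichotomy i j with h | h | h
    · rw [if_pos h, if_neg h.ne, if_pos (by omega), if_pos h.le]; ring
    · subst h
      simp; ring
    · rw [if_neg (by omega), if_neg (by omega), if_neg (by omega), if_neg (by omega)]; ring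
  rw [Finset.sum_congr rfl fun i _ => hG i, telesZ G _ _ (by omega)]
  simp only [G]
  rw [if_neg (by omega), if_pos (by omega), hA N (hsN _ (by omega)), hA (-N) (hsN _ (by omega))]
  simp only [E2]
  rw [show exp θ = exp σ * exp β by rw [← exp_add]; congr 1; linarith]
  ring
end

section
/- Let g: ℕ → [0,∞) be nondecreasing with g(0) = 0 and g(z) > 0 for z ≥ 1, let p = 1, let θ, σ be real numbers with Z(θ), Z(σ) < ∞, let μ̂ be a probability distribution on ℕ, and suppose the single-shock measure ν_j satisfies the random walking shock property with some rates P, Q ≥ 0. Then necessarily μ̂ = μ^σ, Q = 0, and there exists a constant c > 0 such that g(y+1) − g(y) = c·e^{(θ−σ)y} for every y ∈ ℕ (so g(y) = 𝔞̂·e^{(θ−σ)y} + 𝔟 for suitable constants 𝔞̂, 𝔟 when θ ≠ σ, and g is linear when θ = σ). -/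
open MeasureTheory Real

/-- Cylinder event: the sites in `s` have the prescribed values `f`. -/
def Ev (s : Finset ℤ) (f : ℤ → ℕ × ℕ) : Set (ConfN × ConfN) :=
  {x | ∀ i ∈ s, (x.1 i, x.2 i) ∈ ({f i} : Set (ℕ × ℕ))}

lemma meas_Ev (s : Finset ℤ) (f : ℤ → ℕ × ℕ) : MeasurableSet (Ev s f) := by
  have : Ev s f = ⋂ i ∈ s, (fun x : ConfN × ConfN => (x.1 i, x.2 i)) ⁻¹' {f i} := by
    ext x; simp [Ev]
  rw [this]
  refine Finset.measurableSet_biInter s fun i _ => ?_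
  have hm : Measurable (fun x : ConfN × ConfN => (x.1 i, x.2 i)) := by fun_prop
  exact hm (measurableSet_singleton _)

lemma cyl_Ev (s : Finset ℤ) (f : ℤ → ℕ × ℕ) :
    IsBddCylinder ((Ev s f).indicator (1 : ConfN × ConfN → ℝ)) := by
  classical
  refine ⟨⟨s, fun x y h => ?_⟩, 1, fun x => ?_⟩
  · have : x ∈ Ev s f ↔ y ∈ Ev s f := by
      simp only [Ev, Set.mem_setOf_eq]
      refine forall₂_congr fun i hi => ?_
      rw [(h i hi).1, (h i hi).2]
    simp only [Set.indicator_apply, this, Pi.one_apply]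
  · rw [Set.indicator_apply]; split_ifs <;> simp

/-- Mass function of the shock factor. -/
noncomputable def fm (g : ℕ → ℝ) (θ σ : ℝ) (μhat : ℕ → ℝ) (j i : ℤ) (yz : ℕ × ℕ) : ℝ :=
  if i < j then (if yz.2 = yz.1 then muN g θ yz.1 else 0)
  else if i = j then (if yz.2 = yz.1 + 1 then μhat yz.1 else 0)
  else (if yz.2 = yz.1 then muN g σ yz.1 else 0)

lemma shock_fm (g : ℕ → ℝ) (θ σ : ℝ) (μhat : ℕ → ℝ) (j i : ℤ) :
    shockFactor g θ σ μhat j i = siteMeasure (fm g θ σ μhat j i) := by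
  unfold shockFactor fm
  split_ifs <;> rfl

lemma site_singleton (f : ℕ × ℕ → ℝ) (a : ℕ × ℕ) :
    siteMeasure f {a} = ENNReal.ofReal (f a) := by
  unfold siteMeasure
  rw [withDensity_apply _ (measurableSet_singleton a), lintegral_singleton]
  simp

lemma site_null (f : ℕ × ℕ → ℝ) (B : Set (ℕ × ℕ)) (h : ∀ a ∈ B, f a = 0) :
    siteMeasure f B = 0 := by
  rw [← Set.biUnion_of_singleton B, measure_biUnion_null_iff B.to_countable]
  intro a ha
  rw [site_singleton, h a ha]; simp

lemma gfact_pos (g : ℕ → ℝ) (hgpos : ∀ z : ℕ, 1 ≤ z → 0 < g z) (z : ℕ) : 0 < gfact g z :=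
  Finset.prod_pos fun i hi => hgpos i (Finset.mem_Icc.1 hi).1

lemma ZN_pos (g : ℕ → ℝ) (hgpos : ∀ z : ℕ, 1 ≤ z → 0 < g z) (θ : ℝ)
    (hZ : Summable fun z : ℕ => exp (θ * z) / gfact g z) : 0 < ZN g θ :=
  hZ.tsum_pos (fun z => (div_pos (exp_pos _) (gfact_pos g hgpos z)).le) 0
    (div_pos (exp_pos _) (gfact_pos g hgpos 0))

lemma muN_pos (g : ℕ → ℝ) (hgpos : ∀ z : ℕ, 1 ≤ z → 0 < g z) (θ : ℝ)
    (hZ : Summable fun z : ℕ => exp (θ * z) / gfact g z) (z : ℕ) : 0 < muN g θ z :=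
  div_pos (exp_pos _) (mul_pos (gfact_pos g hgpos z) (ZN_pos g hgpos θ hZ))

lemma muN_sum (g : ℕ → ℝ) (hgpos : ∀ z : ℕ, 1 ≤ z → 0 < g z) (θ : ℝ)
    (hZ : Summable fun z : ℕ => exp (θ * z) / gfact g z) : ∑' z, muN g θ z = 1 := by
  have : ∀ z, muN g θ z = (exp (θ * z) / gfact g z) / ZN g θ := fun z => by
    unfold muN; rw [div_div]
  simp_rw [this]
  rw [tsum_div_const]
  exact div_self (ZN_pos g hgpos θ hZ).ne'

section core
variable (g : ℕ → ℝ) (θ σ : ℝ) (μhat : ℕ → ℝ) (ν : ℤ → Measure (ConfN × ConfN))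

lemma fm_nonneg (h1 : ∀ z, 0 ≤ muN g θ z) (h2 : ∀ z, 0 ≤ muN g σ z) (h3 : ∀ z, 0 ≤ μhat z)
    (j i : ℤ) (a : ℕ × ℕ) : 0 ≤ fm g θ σ μhat j i a := by
  unfold fm; split_ifs <;> simp [h1, h2, h3]

lemma int_Ev (hν : ∀ j : ℤ, IsProductMeasure (shockFactor g θ σ μhat j) (ν j))
    (h0 : ∀ j i a, 0 ≤ fm g θ σ μhat j i a)
    (j : ℤ) (s : Finset ℤ) (f : ℤ → ℕ × ℕ) :
    ∫ x, (Ev s f).indicator (1 : ConfN × ConfN → ℝ) x ∂(ν j)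
      = ∏ i ∈ s, fm g θ σ μhat j i (f i) := by
  rw [integral_indicator_one (meas_Ev s f), Measure.real]
  have := hν j s (fun i => {f i})
  unfold Ev
  rw [this, ENNReal.toReal_prod]
  refine Finset.prod_congr rfl fun i _ => ?_
  rw [shock_fm, site_singleton, ENNReal.toReal_ofReal (h0 _ _ _)]

lemma ae_supp (hν : ∀ j : ℤ, IsProductMeasure (shockFactor g θ σ μhat j) (ν j)) (j : ℤ) :
    ∀ᵐ x ∂(ν j), ∀ i, fm g θ σ μhat j i (x.1 i, x.2 i) ≠ 0 := by
  rw [ae_all_iff]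
  intro i
  rw [ae_iff]
  have := hν j {i} (fun _ => {a | fm g θ σ μhat j i a = 0})
  simp only [Finset.mem_singleton, forall_eq, Finset.prod_singleton, Set.mem_setOf_eq] at this
  simp only [ne_eq, not_not]
  rw [this, shock_fm]
  exact site_null _ _ fun a ha => ha

lemma supp_struct {j : ℤ} {x : ConfN × ConfN}
    (h : ∀ i, fm g θ σ μhat j i (x.1 i, x.2 i) ≠ 0) :
    (∀ i, i ≠ j → x.2 i = x.1 i) ∧ x.2 j = x.1 j + 1 ∧ μhat (x.1 j) ≠ 0 := by
  refine ⟨fun i hi => ?_, ?_, ?_⟩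
  · have := h i
    unfold fm at this
    by_contra hc
    simp [hc, hi] at this
  · have := h j
    unfold fm at this
    by_contra hc
    simp [hc] at this
  · have := h j
    unfold fm at this
    intro hc
    simp [hc] at this

end core

/-- The totally asymmetric generator on a single-discrepancy configuration. -/
lemma LN_one (g : ℕ → ℝ) (hg0 : g 0 = 0) (φ : ConfN × ConfN → ℝ) (x : ConfN × ConfN) (j : ℤ)
    (h1 : ∀ i, i ≠ j → x.2 i = x.1 i)
    (h2 : ∀ i, i ≠ j → x.1 i ≠ 0 → φ (moveN x.1 i (i + 1), moveN x.2 i (i + 1)) = φ x) :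
    LN 1 g φ x = g (x.1 j) * (φ (moveN x.1 j (j + 1), moveN x.2 j (j + 1)) - φ x)
      + (g (x.2 j) - g (x.1 j)) * (φ (x.1, moveN x.2 j (j + 1)) - φ x) := by
  unfold LN
  rw [tsum_eq_single j]
  · ring
  · intro i hi
    rw [h1 i hi]
    by_cases h : x.1 i = 0
    · rw [h, hg0]; ring
    · have := h2 i hi h
      rw [this]; ring

/-- Necessity, totally asymmetric case (`p = 1`): if the single-shock measure satisfies the
random walking shock property with some rates `P, Q ≥ 0`, then `μ̂ = μ^σ`, `Q = 0`, and
`g(y+1) - g(y) = c·e^{(θ-σ)y}` for some constant `c > 0`. -/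
theorem rws_necessity_totally_asymmetric
    (g : ℕ → ℝ) (hmono : Monotone g) (hg0 : g 0 = 0)
    (hgpos : ∀ z : ℕ, 1 ≤ z → 0 < g z)
    (θ σ : ℝ)
    (hZθ : Summable fun z : ℕ => exp (θ * z) / gfact g z)
    (hZσ : Summable fun z : ℕ => exp (σ * z) / gfact g z)
    (μhat : ℕ → ℝ) (hμhat : (∀ y : ℕ, 0 ≤ μhat y) ∧ (∑' y : ℕ, μhat y) = 1)
    (P Q : ℝ) (hP : 0 ≤ P) (hQ : 0 ≤ Q)
    (ν : ℤ → Measure (ConfN × ConfN))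
    (hν : ∀ j : ℤ, IsProductMeasure (shockFactor g θ σ μhat j) (ν j))
    (j : ℤ)
    (hRWS : ∀ φ : ConfN × ConfN → ℝ, IsBddCylinder φ →
      ∫ x, LN 1 g φ x ∂(ν j)
        = P * ((∫ x, φ x ∂(ν (j + 1))) - ∫ x, φ x ∂(ν j))
          + Q * ((∫ x, φ x ∂(ν (j - 1))) - ∫ x, φ x ∂(ν j))) :
    (∀ z : ℕ, μhat z = muN g σ z) ∧ Q = 0 ∧
      ∃ c : ℝ, 0 < c ∧ ∀ y : ℕ, g (y + 1) - g y = c * exp ((θ - σ) * y) := by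
  have hθp := muN_pos g hgpos θ hZθ
  have hσp := muN_pos g hgpos σ hZσ
  have h0 := fm_nonneg g θ σ μhat (fun z => (hθp z).le) (fun z => (hσp z).le) hμhat.1
  have hI := int_Ev g θ σ μhat ν hν h0
  have hae := ae_supp g θ σ μhat ν hν j
  have hne : ∃ y, μhat y ≠ 0 := by
    by_contra hc
    push Not at hc
    have := hμhat.2
    simp [hc] at this
  -- Q = 0
  have hQ0 : Q = 0 := by
    obtain ⟨y, hy⟩ := hne
    have h := hRWS _ (cyl_Ev {j - 1} (fun _ => (y, y + 1)))
    rw [hI, hI, hI] at h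
    have hL : ∫ x, LN 1 g ((Ev {j - 1} (fun _ => (y, y + 1))).indicator 1) x ∂(ν j) = 0 := by
      refine integral_eq_zero_of_ae ?_
      filter_upwards [hae] with x hx
      obtain ⟨s1, s2, s3⟩ := supp_struct g θ σ μhat hx
      have s4 := s1 (j - 1) (by omega)
      have e0 : x ∉ Ev {j - 1} (fun _ => (y, y + 1)) := by
        simp [Ev]; omega
      have e1 : ∀ i, (moveN x.1 i (i + 1), moveN x.2 i (i + 1)) ∉
          Ev {j - 1} (fun _ => (y, y + 1)) := by
        intro i; simp [Ev, moveN]; grind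
      have e2 : (x.1, moveN x.2 j (j + 1)) ∉ Ev {j - 1} (fun _ => (y, y + 1)) := by
        simp [Ev, moveN]; grind
      rw [LN_one g hg0 _ x j s1 (fun i _ _ => by simp [e0, e1])]
      simp [e0, e1, e2]
    rw [hL] at h
    simp [fm] at h
    grind
  -- main identity
  have hmain : ∀ y z, μhat y * (g (y + 1) - g y) * muN g σ z = P * muN g θ y * μhat z := by
    intro y z
    let f : ℤ → ℕ × ℕ := fun i => if i = j then (y, y) else (z, z + 1)
    let f' : ℤ → ℕ × ℕ := fun i => if i = j then (y, y + 1) else (z, z)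
    have h := hRWS _ (cyl_Ev {j, j + 1} f)
    rw [hI, hI, hI, hQ0] at h
    have hL : ∫ x, LN 1 g ((Ev {j, j + 1} f).indicator 1) x ∂(ν j)
        = ∫ x, (g (y + 1) - g y) * (Ev {j, j + 1} f').indicator 1 x ∂(ν j) := by
      refine integral_congr_ae ?_
      filter_upwards [hae] with x hx
      obtain ⟨s1, s2, s3⟩ := supp_struct g θ σ μhat hx
      have s4 := s1 (j + 1) (by omega)
      have e0 : x ∉ Ev {j, j + 1} f := by
        simp [Ev, f]; omega
      have e1 : ∀ i, x.1 i ≠ 0 → (moveN x.1 i (i + 1), moveN x.2 i (i + 1)) ∉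
          Ev {j, j + 1} f := by
        intro i hi; simp [Ev, moveN, f]; grind
      have e2 : (x.1, moveN x.2 j (j + 1)) ∈ Ev {j, j + 1} f ↔ x ∈ Ev {j, j + 1} f' := by
        simp [Ev, moveN, f, f']; grind
      rw [LN_one g hg0 _ x j s1 (fun i _ hi => by simp [e0, e1 i hi])]
      have e3 : g (x.1 j) * ((Ev {j, j + 1} f).indicator (1 : ConfN × ConfN → ℝ)
          (moveN x.1 j (j + 1), moveN x.2 j (j + 1)) - (Ev {j, j + 1} f).indicator 1 x) = 0 := by
        by_cases hi : x.1 j = 0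
        · rw [hi, hg0, zero_mul]
        · simp [e0, e1 j hi]
      rw [e3]
      by_cases hm : x ∈ Ev {j, j + 1} f'
      · have e4 : x.1 j = y := by
          have := hm j (by simp)
          simp [f'] at this
          exact this.1
        simp [e0, e2.2 hm, hm, s2, e4]
      · have := mt e2.1 hm
        simp [e0, this, hm]
    rw [hL, integral_const_mul, hI] at h
    have hj : j ≠ j + 1 := by omega
    have hj' : ¬ (j + 1 < j) := by omega
    simp [fm, f, f', Finset.prod_pair hj] at h
    linarith
  have hμs : Summable μhat := by
    by_contra hc
    have := hμhat.2
    rw [tsum_eq_zero_of_not_summable hc] at this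
    exact zero_ne_one this
  have hsum : ∀ y, μhat y * (g (y + 1) - g y) = P * muN g θ y := by
    intro y
    have := congrArg tsum (funext (hmain y))
    rw [tsum_mul_left, tsum_mul_left, hμhat.2, muN_sum g hgpos σ hZσ] at this
    linarith
  -- P > 0
  have hPne : P ≠ 0 := by
    intro hP0
    have hz : ∀ y, μhat y = 0 → (∀ k, k + 1 = y → μhat k = 0) → μhat (y + 1) = 0 := by
      intro y hy hk
      have h := hRWS _ (cyl_Ev {j} (fun _ => (y, y + 1)))
      rw [hP0, hQ0] at h
      have hL : ∫ x, LN 1 g ((Ev {j} (fun _ => (y, y + 1))).indicator 1) x ∂(ν j)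
          = ∫ x, g (y + 1) * (Ev {j} (fun _ => (y + 1, y + 2))).indicator 1 x ∂(ν j) := by
        refine integral_congr_ae ?_
        filter_upwards [hae] with x hx
        obtain ⟨s1, s2, s3⟩ := supp_struct g θ σ μhat hx
        have n1 : x.1 j ≠ y := by
          intro hc; rw [hc] at s3; exact s3 hy
        have n2 : x.1 j + 1 ≠ y := fun hc => s3 (hk _ hc)
        have e0 : x ∉ Ev {j} (fun _ => (y, y + 1)) := by
          simp [Ev]; omega
        have e1 : ∀ i, i ≠ j → (moveN x.1 i (i + 1), moveN x.2 i (i + 1)) ∉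
            Ev {j} (fun _ => (y, y + 1)) := by
          intro i hi; simp [Ev, moveN]; grind
        have e2 : (x.1, moveN x.2 j (j + 1)) ∉ Ev {j} (fun _ => (y, y + 1)) := by
          simp [Ev, moveN]; grind
        have e3 : (moveN x.1 j (j + 1), moveN x.2 j (j + 1)) ∈ Ev {j} (fun _ => (y, y + 1)) ↔
            x ∈ Ev {j} (fun _ => (y + 1, y + 2)) := by
          simp [Ev, moveN]; grind
        rw [LN_one g hg0 _ x j s1 (fun i hi _ => by simp [e0, e1 i hi])]
        by_cases hm : x ∈ Ev {j} (fun _ => (y + 1, y + 2))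
        · have e4 : x.1 j = y + 1 := by
            have := hm j (by simp)
            simp at this
            exact this.1
          simp [e0, e2, e3.2 hm, hm, e4]
        · have := mt e3.1 hm
          simp [e0, e2, this, hm]
      rw [hL, integral_const_mul, hI] at h
      simp [fm] at h
      exact h.resolve_left (hgpos (y + 1) (by omega)).ne'
    have hz0 : μhat 0 = 0 := by
      have h := hsum 0
      rw [hP0, hg0] at h
      have := hgpos 1 le_rfl
      simp at h
      exact h.resolve_right this.ne'
    have hall : ∀ y, μhat y = 0 ∧ μhat (y + 1) = 0 := by
      intro y
      induction y with
      | zero => exact ⟨hz0, hz 0 hz0 (fun k hk => by omega)⟩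
      | succ n ih =>
        refine ⟨ih.2, hz (n + 1) ih.2 (fun k hk => ?_)⟩
        have : k = n := by omega
        rw [this]; exact ih.1
    obtain ⟨y, hy⟩ := hne
    exact hy (hall y).1
  have hPpos : 0 < P := lt_of_le_of_ne hP hPne.symm
  have hhat : ∀ z, μhat z = muN g σ z := by
    intro z
    have h := hmain 0 z
    rw [hsum 0] at h
    exact (mul_left_cancel₀ (mul_pos hPpos (hθp 0)).ne' h).symm
  refine ⟨hhat, hQ0, P * ZN g σ / ZN g θ, ?_, ?_⟩
  · exact div_pos (mul_pos hPpos (ZN_pos g hgpos σ hZσ)) (ZN_pos g hgpos θ hZθ)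
  · intro y
    have h := hsum y
    rw [hhat] at h
    have a1 := ZN_pos g hgpos σ hZσ
    have a2 := ZN_pos g hgpos θ hZθ
    have a3 := gfact_pos g hgpos y
    have a4 : exp (θ * y) = exp ((θ - σ) * y) * exp (σ * y) := by
      rw [← exp_add]; ring_nf
    have a5 := exp_pos (σ * y)
    unfold muN at h
    rw [a4] at h
    field_simp at h
    field_simp
    rw [mul_comm (θ - σ), h]; ring
end
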